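/- arXiv:2402.15329 — 2 statements merged into one kernel-verified Lean document; each statement's English description precedes it below -/
import Mathlib

section
/- Let n ≥ 1 and let λ₁, λ₂, λ₃ be pairwise distinct nonzero complex numbers with f(x) = (x−λ₁)(x−λ₂)(x−λ₃). Suppose a₀, a₁, …, aₙ and b₁, …, bₙ are polynomials in ℂ[t] such that for each 1 ≤ i ≤ n one has bᵢ² = aᵢ₋₁²·f(aᵢ) in ℂ[t] and the three polynomials aᵢ₋₁, aᵢ, bᵢ have no common zero in ℂ. Then aᵢ is a constant polynomial for every 1 ≤ i ≤ n, and bᵢ is a constant polynomial for every 2 ≤ i ≤ n. (This is the polynomial translation of the lemma that for any morphism γ : 𝔸¹_ℂ → Xₙ, the composite ψₙ ∘ γ is a constant morphism, where ψₙ projects Xₙ onto the coordinates (x₁, x₂, y₂, …, xₙ, yₙ).) -/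
open Polynomial

theorem Polynomial.isSquare_of_associated_sq {k : Type*} [Field k] [IsAlgClosed k] {p d : k[X]}
    (h : Associated (d ^ 2) p) : IsSquare p := by
  obtain ⟨u, rfl⟩ := h
  obtain ⟨c, -, hc⟩ := Polynomial.isUnit_iff.mp u.isUnit
  obtain ⟨e, rfl⟩ := IsAlgClosed.exists_eq_mul_self c
  exact ⟨d * C e, by rw [← hc, C_mul]; ring⟩

theorem Polynomial.isSquare_of_mul_eq_sq {k : Type*} [Field k] [IsAlgClosed k] {p q c : k[X]}
    (hpq : IsCoprime p q) (h : p * q = c ^ 2) : IsSquare p := by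
  obtain ⟨d, hd⟩ := exists_associated_pow_of_mul_eq_pow' hpq h
  exact isSquare_of_associated_sq hd

theorem Polynomial.isCoprime_sub_C_sub_C {k : Type*} [Field k] (a : k[X]) {x y : k} (h : x ≠ y) :
    IsCoprime (a - C x) (a - C y) := by
  have h' : (y - x) ≠ 0 := sub_ne_zero.mpr h.symm
  refine ⟨C (y - x)⁻¹, -C (y - x)⁻¹, ?_⟩
  calc C (y - x)⁻¹ * (a - C x) + -C (y - x)⁻¹ * (a - C y)
      = C ((y - x)⁻¹ * (y - x)) := by rw [C_mul, C_sub]; ring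
    _ = 1 := by rw [inv_mul_cancel₀ h', C_1]

/-- If two distinct translates of a polynomial are squares, the polynomial is constant. -/
theorem Polynomial.exists_eq_C_of_isSquare_sub_C {k : Type*} [Field k] [NeZero (2 : k)] {a : k[X]}
    {x y : k} (h : x ≠ y) (hx : IsSquare (a - C x)) (hy : IsSquare (a - C y)) :
    ∃ c : k, a = C c := by
  obtain ⟨p, hp⟩ := hx
  obtain ⟨q, hq⟩ := hy
  have hu : IsUnit ((p - q) * (p + q)) := by
    have : (p - q) * (p + q) = C (y - x) := by
      rw [C_sub]; linear_combination hq - hp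
    rw [this]
    exact isUnit_C.mpr (sub_ne_zero.mpr h.symm).isUnit
  obtain ⟨r, -, hr⟩ := isUnit_iff.mp (isUnit_of_mul_isUnit_left hu)
  obtain ⟨s, -, hs⟩ := isUnit_iff.mp (isUnit_of_mul_isUnit_right hu)
  have h2 : (C (2⁻¹ : k)) * 2 = 1 := by
    rw [← C_ofNat, ← C_mul, inv_mul_cancel₀ (NeZero.ne (2 : k)), C_1]
  have hpc : p = C (2⁻¹ * (r + s)) := by
    rw [C_mul, C_add, hr, hs]; linear_combination -p * h2
  exact ⟨(2⁻¹ * (r + s)) * (2⁻¹ * (r + s)) + x, by rw [C_add, C_mul, ← hpc, ← hp]; ring⟩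

/-- A polynomial `a` for which `(a - x) (a - y) (a - z)` is a square is constant, the affine curve
`v² = (u - x) (u - y) (u - z)` having no nonconstant polynomial points. -/
theorem Polynomial.exists_eq_C_of_sq_eq_cubic {k : Type*} [Field k] [IsAlgClosed k]
    [NeZero (2 : k)] {a c : k[X]} {x y z : k} (hxy : x ≠ y) (hxz : x ≠ z) (hyz : y ≠ z)
    (h : c ^ 2 = (a - C x) * (a - C y) * (a - C z)) : ∃ r : k, a = C r := by
  refine exists_eq_C_of_isSquare_sub_C hxy
    (isSquare_of_mul_eq_sq (q := (a - C y) * (a - C z)) (c := c) ?_ (by rw [h]; ring))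
    (isSquare_of_mul_eq_sq (q := (a - C x) * (a - C z)) (c := c) ?_ (by rw [h]; ring))
  · exact (isCoprime_sub_C_sub_C a hxy).mul_right (isCoprime_sub_C_sub_C a hxz)
  · exact (isCoprime_sub_C_sub_C a hxy.symm).mul_right (isCoprime_sub_C_sub_C a hyz)

theorem Polynomial.exists_eq_C_of_sq_eq_C {R : Type*} [CommRing R] [IsDomain R] {p : R[X]} {r : R}
    (h : p ^ 2 = C r) : ∃ s : R, p = C s := by
  have h0 : p.natDegree = 0 := by
    have := congrArg natDegree h
    rw [natDegree_pow, natDegree_C] at this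
    omega
  exact ⟨_, eq_C_of_natDegree_eq_zero h0⟩

theorem Polynomial.exists_eq_C_of_forall_eval_ne_zero {k : Type*} [Field k] [IsAlgClosed k]
    {p : k[X]} (h : ∀ t, p.eval t ≠ 0) : ∃ r : k, p = C r := by
  refine ⟨_, eq_C_of_degree_le_zero ?_⟩
  by_contra hd
  obtain ⟨t, ht⟩ := IsAlgClosed.exists_root p (fun h0 => hd h0.le)
  exact h t ht

/-- Let `n ≥ 1` and `λ₁, λ₂, λ₃` pairwise distinct nonzero complex
numbers with `f(x) = (x−λ₁)(x−λ₂)(x−λ₃)`.  Suppose `a₀, …, aₙ, b₁, …, bₙ ∈ ℂ[t]`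
(here `a i` is `aᵢ` for `i : Fin (n+1)` and `b i` is `b_{i+1}` for `i : Fin n`) satisfy,
for each `1 ≤ i ≤ n`, `bᵢ² = aᵢ₋₁²·f(aᵢ)` and `aᵢ₋₁, aᵢ, bᵢ` have no common zero in `ℂ`.
Then `aᵢ` is constant for every `1 ≤ i ≤ n` and `bᵢ` is constant for every `2 ≤ i ≤ n`.
(For every morphism `γ : 𝔸¹ → Xₙ`, the composite `ψₙ ∘ γ` is constant.) -/
theorem psi_comp_constant
    (n : ℕ) (hn : 1 ≤ n)
    (l1 l2 l3 : ℂ) (h1 : l1 ≠ 0) (h2 : l2 ≠ 0) (h3 : l3 ≠ 0)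
    (h12 : l1 ≠ l2) (h13 : l1 ≠ l3) (h23 : l2 ≠ l3)
    (a : Fin (n + 1) → Polynomial ℂ) (b : Fin n → Polynomial ℂ)
    (heq : ∀ i : Fin n,
      (b i) ^ 2 = (a i.castSucc) ^ 2 *
        ((a i.succ - C l1) * (a i.succ - C l2) * (a i.succ - C l3)))
    (hnz : ∀ i : Fin n, ∀ t : ℂ,
      ¬ ((a i.castSucc).eval t = 0 ∧ (a i.succ).eval t = 0 ∧ (b i).eval t = 0)) :
    (∀ i : Fin n, ∃ k : ℂ, a i.succ = C k) ∧
    (∀ i : Fin n, 1 ≤ (i : ℕ) → ∃ k : ℂ, b i = C k) := by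
  have ha : ∀ i : Fin n, ∃ k : ℂ, a i.succ = C k := by
    intro i
    by_cases h0 : a i.castSucc = 0
    · have hb : b i = 0 := by simpa [h0] using heq i
      exact exists_eq_C_of_forall_eval_ne_zero fun t ht => hnz i t (by simp [h0, hb, ht])
    · obtain ⟨c, hc⟩ : a i.castSucc ∣ b i :=
        (IsIntegrallyClosed.pow_dvd_pow_iff two_ne_zero).mp ⟨_, heq i⟩
      refine exists_eq_C_of_sq_eq_cubic h12 h13 h23 (c := c)
        (mul_left_cancel₀ (pow_ne_zero 2 h0) ?_)
      rw [← heq i, hc]; ring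
  refine ⟨ha, fun i hi => ?_⟩
  obtain ⟨r, hr⟩ := ha i
  obtain ⟨s, hs⟩ : ∃ s : ℂ, a i.castSucc = C s := by
    obtain ⟨j, hj⟩ : ∃ j : Fin n, j.succ = i.castSucc :=
      ⟨⟨i - 1, by omega⟩, Fin.ext (by simp; omega)⟩
    rw [← hj]
    exact ha j
  refine exists_eq_C_of_sq_eq_C (r := s ^ 2 * ((r - l1) * (r - l2) * (r - l3))) ?_
  rw [heq i, hr, hs]
  simp
end

section
/- Suppose a, b, c are polynomials in ℂ[t] such that c² = a²·f(b) in ℂ[t] and a, b, c have no common zero in ℂ, where f(x) = (x−λ₁)(x−λ₂)(x−λ₃) for pairwise distinct nonzero complex numbers λ₁, λ₂, λ₃. Then b is a constant polynomial. (This is the base case n = 1 of the lemma that ψₙ ∘ γ is constant for every morphism γ : 𝔸¹_ℂ → Xₙ: for every morphism γ : 𝔸¹_ℂ → X₁, the composite ψ₁ ∘ γ with the projection to the x₁-axis is constant.) -/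
open Polynomial

/-- If a product of two coprime polynomials over `ℂ` is a square, then the first factor is a
square. -/
lemma Polynomial.exists_eq_sq_of_isCoprime_of_mul_eq_sq {p q d : ℂ[X]} (hpq : IsCoprime p q)
    (h : p * q = d ^ 2) : ∃ u : ℂ[X], p = u ^ 2 := by
  obtain ⟨e, v, hv⟩ := exists_associated_pow_of_mul_eq_pow' hpq h
  obtain ⟨r, -, hr⟩ := Polynomial.isUnit_iff.mp v.isUnit
  obtain ⟨s, hs⟩ := IsAlgClosed.exists_pow_nat_eq r (n := 2) two_pos
  exact ⟨e * C s, by rw [← hv, ← hr, ← hs, C_pow, mul_pow]⟩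

lemma Polynomial.isCoprime_sub_C_sub_C_s6 {K : Type*} [Field K] (b : K[X]) {r s : K} (h : r ≠ s) :
    IsCoprime (b - C r) (b - C s) := by
  have hC : C (s - r)⁻¹ * (C s - C r) = 1 := by
    rw [← C_sub, ← C_mul, inv_mul_cancel₀ (sub_ne_zero.mpr h.symm), C_1]
  exact ⟨C (s - r)⁻¹, -C (s - r)⁻¹, by linear_combination hC⟩

/-- If a polynomial times the square of a nonzero polynomial is a square, then the polynomial is
itself a square. -/
lemma Polynomial.exists_eq_sq_of_sq_eq_sq_mul {K : Type*} [Field K] {a c p : K[X]} (ha : a ≠ 0)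
    (h : c ^ 2 = a ^ 2 * p) : ∃ d : K[X], p = d ^ 2 := by
  obtain ⟨d, rfl⟩ : a ∣ c := (IsIntegrallyClosed.pow_dvd_pow_iff two_ne_zero).mp ⟨p, h⟩
  exact ⟨d, mul_left_cancel₀ (pow_ne_zero 2 ha) (by rw [← h, mul_pow])⟩

/-- If two distinct translates of a polynomial by constants are both squares, then the polynomial
is constant. -/
lemma Polynomial.exists_eq_C_of_sub_C_eq_sq {K : Type*} [Field K] [NeZero (2 : K)] {b u v : K[X]}
    {r s : K} (h : r ≠ s) (hu : b - C r = u ^ 2) (hv : b - C s = v ^ 2) : ∃ k : K, b = C k := by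
  have huv : (u - v) * (u + v) = C (s - r) := by
    rw [C_sub]; linear_combination hv - hu
  have hunit : IsUnit ((u - v) * (u + v)) := by
    rw [huv]; exact isUnit_C.mpr (sub_ne_zero.mpr h.symm).isUnit
  obtain ⟨x, -, hx⟩ := Polynomial.isUnit_iff.mp (isUnit_of_mul_isUnit_left hunit)
  obtain ⟨y, -, hy⟩ := Polynomial.isUnit_iff.mp (isUnit_of_mul_isUnit_right hunit)
  have h2 : (C (2 : K)⁻¹) * 2 = 1 := by
    rw [← C_ofNat, ← C_mul, inv_mul_cancel₀ two_ne_zero, C_1]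
  have hu' : u = C (2⁻¹ * (x + y)) := by
    rw [C_mul, C_add]; linear_combination -u * h2 - C (2 : K)⁻¹ * (hx + hy)
  exact ⟨(2⁻¹ * (x + y)) ^ 2 + r, by rw [C_add, C_pow, ← hu']; linear_combination hu⟩

/-- If `a, b, c ∈ ℂ[t]` satisfy `c² = a²·f(b)` and have no common zero
in `ℂ`, where `f(x) = (x−λ₁)(x−λ₂)(x−λ₃)` for pairwise distinct nonzero `λᵢ`, then `b`
is a constant polynomial.  (For every morphism `γ : 𝔸¹ → X₁`, `ψ₁ ∘ γ` is constant.) -/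
theorem x1_coordinate_constant
    (l1 l2 l3 : ℂ) (h1 : l1 ≠ 0) (h2 : l2 ≠ 0) (h3 : l3 ≠ 0)
    (h12 : l1 ≠ l2) (h13 : l1 ≠ l3) (h23 : l2 ≠ l3)
    (a b c : Polynomial ℂ)
    (heq : c ^ 2 = a ^ 2 * ((b - C l1) * (b - C l2) * (b - C l3)))
    (hnz : ∀ t : ℂ, ¬ (a.eval t = 0 ∧ b.eval t = 0 ∧ c.eval t = 0)) :
    ∃ k : ℂ, b = C k := by
  rcases eq_or_ne a 0 with rfl | ha
  · have hc : c = 0 := by simpa using heq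
    refine ⟨b.coeff 0, eq_C_of_degree_eq_zero (not_imp_comm.mp (IsAlgClosed.exists_root b) ?_)⟩
    rintro ⟨t, ht⟩
    exact hnz t ⟨eval_zero, ht, by rw [hc, eval_zero]⟩
  · obtain ⟨d, hd⟩ := exists_eq_sq_of_sq_eq_sq_mul ha heq
    have c12 := isCoprime_sub_C_sub_C_s6 b h12
    have c13 := isCoprime_sub_C_sub_C_s6 b h13
    have c23 := isCoprime_sub_C_sub_C_s6 b h23
    obtain ⟨u, hu⟩ := exists_eq_sq_of_isCoprime_of_mul_eq_sq (d := d) (c12.mul_right c13)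
      (by rw [← hd, mul_assoc])
    obtain ⟨v, hv⟩ := exists_eq_sq_of_isCoprime_of_mul_eq_sq (d := d) (c12.symm.mul_right c23)
      (by rw [← hd]; ring)
    exact exists_eq_C_of_sub_C_eq_sq h12 hu hv
end
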